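/- Let n ≥ 1 and t ≥ 1 be integers. For every ε > 0 there exists p₀ such that for every integer p ≥ p₀ and every digit set D ⊆ {0,…,p−1}^n with #D ≥ p^n − t, one has dim_{l¹} λ_{p,D} ≥ n − ε. In other words, liminf_{p→∞, #D ≥ p^n − t} dim_{l¹} λ_{p,D} = n. -/

import Mathlib

open MeasureTheory Metric Filter Set
open scoped ENNReal NNReal Real Topology

noncomputable section

/-- The Fourier transform of a measure on ℝⁿ: `μ̂(ξ) = ∫ e^{-2πi⟨x,ξ⟩} dμ(x)`. -/
def mft {n : ℕ} (μ : Measure (EuclideanSpace ℝ (Fin n))) (ξ : EuclideanSpace ℝ (Fin n)) : ℂ :=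
  ∫ x, Complex.exp ((((-(2 * Real.pi * (inner ℝ x ξ : ℝ))) : ℝ) : ℂ) * Complex.I) ∂μ

/-- A lattice point `ξ ∈ ℤⁿ` viewed as an element of ℝⁿ. -/
def lat {n : ℕ} (ξ : Fin n → ℤ) : EuclideanSpace ℝ (Fin n) := WithLp.toLp 2 fun i => (ξ i : ℝ)

/-- The box `[0,1]ⁿ`. -/
def box01 (n : ℕ) : Set (EuclideanSpace ℝ (Fin n)) := {θ | ∀ i, θ i ∈ Set.Icc (0 : ℝ) 1}

/-- `g(ξ) = (1/#D) Σ_{d ∈ D} e^{-2πi⟨d,ξ⟩}`. -/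
def gD {n : ℕ} (D : Finset (Fin n → ℕ)) (ξ : EuclideanSpace ℝ (Fin n)) : ℂ :=
  (D.card : ℂ)⁻¹ * ∑ d ∈ D,
    Complex.exp ((((-(2 * Real.pi * ∑ i, (d i : ℝ) * ξ i)) : ℝ) : ℂ) * Complex.I)

/-- Sum of `|μ̂(ξ+θ)|` over lattice points `|ξ| ≤ R` (Euclidean norm). -/
def latSum {n : ℕ} (μ : Measure (EuclideanSpace ℝ (Fin n))) (R : ℝ)
    (θ : EuclideanSpace ℝ (Fin n)) : ℝ :=
  ∑' ξ : Fin n → ℤ, if ‖lat ξ‖ ≤ R then ‖mft μ (lat ξ + θ)‖ else 0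

/-- The Fourier `l¹`-dimension of a measure on ℝⁿ. -/
def diml1 {n : ℕ} (μ : Measure (EuclideanSpace ℝ (Fin n))) : ℝ :=
  sSup {s : ℝ | 0 < s ∧ ∃ C : ℝ, 0 < C ∧ ∀ R : ℝ, 1 ≤ R → ∀ θ ∈ box01 n,
    latSum μ R θ ≤ C * R ^ ((n : ℝ) - s)}


/-- one-dimensional Dirichlet sum -/
def dir1 (p : ℕ) (x : ℝ) : ℂ :=
  ∑ d ∈ Finset.range p, Complex.exp ((((-(2 * Real.pi * ((d : ℝ) * x))) : ℝ) : ℂ) * Complex.I)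

lemma norm_dir1_le (p : ℕ) (x : ℝ) : ‖dir1 p x‖ ≤ p := by
  unfold dir1
  refine (norm_sum_le _ _).trans ?_
  simp only [Complex.norm_exp_ofReal_mul_I]
  simp

lemma norm_exp_sub_one (x : ℝ) :
    ‖Complex.exp ((((-(2 * Real.pi * x)) : ℝ) : ℂ) * Complex.I) - 1‖ = 2 * |Real.sin (Real.pi * x)| := by
  have h := Complex.norm_exp_I_mul_ofReal_sub_one (-(2 * Real.pi * x))
  rw [mul_comm] at h
  rw [h]
  have : -(2 * Real.pi * x) / 2 = -(Real.pi * x) := by ring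
  rw [this, Real.sin_neg]
  simp

lemma dir1_mul (p : ℕ) (x : ℝ) : ‖dir1 p x‖ * |Real.sin (Real.pi * x)| ≤ 1 := by
  set z := Complex.exp ((((-(2 * Real.pi * x)) : ℝ) : ℂ) * Complex.I) with hz
  have h1 : dir1 p x = ∑ d ∈ Finset.range p, z ^ d := by
    unfold dir1
    refine Finset.sum_congr rfl fun d _ => ?_
    rw [hz, ← Complex.exp_nat_mul]
    congr 1
    push_cast
    ring
  have h2 := geom_sum_mul z p
  rw [← h1] at h2
  have h3 : ‖dir1 p x‖ * ‖z - 1‖ ≤ 2 := by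
    rw [← norm_mul, h2]
    refine (norm_sub_le _ _).trans ?_
    rw [norm_pow, hz, Complex.norm_exp_ofReal_mul_I]
    norm_num
  rw [hz, norm_exp_sub_one] at h3
  linarith

lemma sin_lower (x : ℝ) (h0 : 0 ≤ x) (h1 : x ≤ 1) : 2 * (x * (1 - x)) ≤ Real.sin (Real.pi * x) := by
  have hpi := Real.pi_pos
  rcases le_total x (1/2) with h | h
  · have := Real.mul_le_sin (x := Real.pi * x) (by positivity) (by nlinarith)
    have e : 2 / Real.pi * (Real.pi * x) = 2 * x := by field_simp
    rw [e] at this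
    nlinarith
  · have := Real.mul_le_sin (x := Real.pi * (1 - x)) (mul_nonneg hpi.le (by linarith)) (by nlinarith)
    have e : 2 / Real.pi * (Real.pi * (1 - x)) = 2 * (1 - x) := by field_simp
    rw [e] at this
    have e2 : Real.sin (Real.pi * (1 - x)) = Real.sin (Real.pi * x) := by
      rw [← Real.sin_pi_sub]; congr 1; ring
    rw [e2] at this
    nlinarith

lemma dir1_pt (p a : ℕ) (ha : a < p) (θ : ℝ) (h0 : 0 ≤ θ) (h1 : θ ≤ 1) :
    ‖dir1 p ((p : ℝ)⁻¹ * (a + θ))‖ ≤ 2 * p * (((a : ℝ) + 1)⁻¹ + ((p : ℝ) - a)⁻¹) := by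
  have hp : (0 : ℝ) < p := by exact_mod_cast (by omega : 0 < p)
  have hap : (a : ℝ) + 1 ≤ p := by exact_mod_cast ha
  have ha0 : (0 : ℝ) ≤ a := by positivity
  have hA : 0 ≤ ((a : ℝ) + 1)⁻¹ := by positivity
  have hB : 0 ≤ ((p : ℝ) - a)⁻¹ := inv_nonneg.2 (by linarith)
  have htriv := norm_dir1_le p ((p : ℝ)⁻¹ * (a + θ))
  rcases Nat.eq_zero_or_pos a with h | h
  · subst h
    refine htriv.trans ?_
    simp only [Nat.cast_zero, zero_add, inv_one] at *
    nlinarith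
  by_cases h' : a + 1 = p
  · have : (p : ℝ) - a = 1 := by rw [← h']; push_cast; ring
    rw [this] at *
    refine htriv.trans ?_
    rw [inv_one]
    nlinarith
  have ha1 : (1 : ℝ) ≤ a := by exact_mod_cast h
  have hap2 : (a : ℝ) + 2 ≤ p := by exact_mod_cast (by omega : a + 2 ≤ p)
  set x := (p : ℝ)⁻¹ * (a + θ) with hx
  have hpx : p * x = a + θ := by rw [hx]; field_simp
  have hx0 : 0 < x := by rw [hx]; positivity
  have hx1 : x < 1 := by
    by_contra hc
    push Not at hc
    nlinarith
  have hs := sin_lower x hx0.le hx1.le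
  have hm := dir1_mul p x
  have hxx : 0 < x * (1 - x) := mul_pos hx0 (by linarith)
  have h3 : ‖dir1 p x‖ * (2 * (x * (1 - x))) ≤ 1 :=
    (mul_le_mul_of_nonneg_left (hs.trans (le_abs_self _)) (norm_nonneg _)).trans hm
  have h4 : ‖dir1 p x‖ ≤ (x⁻¹ + (1 - x)⁻¹) / 2 := by
    have : (x⁻¹ + (1 - x)⁻¹) / 2 = 1 / (2 * (x * (1 - x))) := by
      have : 1 - x ≠ 0 := by linarith
      field_simp
      ring
    rw [this, le_div_iff₀ (by positivity)]
    exact h3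
  have h5 : x⁻¹ ≤ 2 * p * ((a : ℝ) + 1)⁻¹ := by
    rw [← div_eq_mul_inv, le_div_iff₀ (by positivity), ← div_eq_inv_mul, div_le_iff₀ hx0]
    nlinarith
  have h6 : (1 - x)⁻¹ ≤ 2 * p * ((p : ℝ) - a)⁻¹ := by
    rw [← div_eq_mul_inv, le_div_iff₀ (by linarith), ← div_eq_inv_mul, div_le_iff₀ (by linarith)]
    nlinarith
  have h7 : 0 ≤ 2 * p * ((a : ℝ) + 1)⁻¹ := by positivity
  have h8 : 0 ≤ 2 * p * ((p : ℝ) - a)⁻¹ := by positivity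
  linarith

lemma dir1_sum (p : ℕ) (θ : ℝ) (h0 : 0 ≤ θ) (h1 : θ ≤ 1) :
    ∑ a ∈ Finset.range p, ‖dir1 p ((p : ℝ)⁻¹ * (a + θ))‖ ≤ p * (4 * (1 + Real.log p)) := by
  have hH : ∑ a ∈ Finset.range p, ((a : ℝ) + 1)⁻¹ ≤ 1 + Real.log p := by
    have := harmonic_le_one_add_log p
    simpa [harmonic] using this
  have hH2 : ∑ a ∈ Finset.range p, ((p : ℝ) - a)⁻¹ = ∑ a ∈ Finset.range p, ((a : ℝ) + 1)⁻¹ := by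
    rw [← Finset.sum_range_reflect]
    refine Finset.sum_congr rfl fun a ha => ?_
    have := Finset.mem_range.1 ha
    congr 1
    have : ((p - 1 - a : ℕ) : ℝ) = p - 1 - a := by
      rw [Nat.cast_sub (by omega), Nat.cast_sub (by omega)]; simp
    rw [this]; ring
  calc _ ≤ ∑ a ∈ Finset.range p, 2 * p * (((a : ℝ) + 1)⁻¹ + ((p : ℝ) - a)⁻¹) :=
        Finset.sum_le_sum fun a ha => dir1_pt p a (Finset.mem_range.1 ha) θ h0 h1
    _ = 2 * p * (2 * ∑ a ∈ Finset.range p, ((a : ℝ) + 1)⁻¹) := by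
        rw [← Finset.mul_sum, Finset.sum_add_distrib, hH2]; ring
    _ ≤ 2 * p * (2 * (1 + Real.log p)) := by gcongr
    _ = _ := by ring

/-- exponential attached to a digit -/
def ee {n : ℕ} (d : Fin n → ℕ) (ξ : EuclideanSpace ℝ (Fin n)) : ℂ :=
  Complex.exp ((((-(2 * Real.pi * ∑ i, (d i : ℝ) * ξ i)) : ℝ) : ℂ) * Complex.I)

lemma gD_eq {n : ℕ} (D : Finset (Fin n → ℕ)) (ξ : EuclideanSpace ℝ (Fin n)) :
    gD D ξ = (D.card : ℂ)⁻¹ * ∑ d ∈ D, ee d ξ := rfl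

lemma norm_ee {n : ℕ} (d : Fin n → ℕ) (ξ : EuclideanSpace ℝ (Fin n)) : ‖ee d ξ‖ = 1 :=
  Complex.norm_exp_ofReal_mul_I _

lemma norm_gD_le {n : ℕ} (D : Finset (Fin n → ℕ)) (ξ : EuclideanSpace ℝ (Fin n)) :
    ‖gD D ξ‖ ≤ 1 := by
  rw [gD_eq, norm_mul, norm_inv, Complex.norm_natCast]
  have : ‖∑ d ∈ D, ee d ξ‖ ≤ D.card := by
    refine (norm_sum_le _ _).trans ?_
    simp [norm_ee]
  rcases Nat.eq_zero_or_pos D.card with h | h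
  · simp [h]
  · have : (0 : ℝ) < D.card := by exact_mod_cast h
    rw [← div_eq_inv_mul, div_le_one this]
    assumption

lemma ee_periodic {n : ℕ} (d : Fin n → ℕ) (ξ : EuclideanSpace ℝ (Fin n)) (η : Fin n → ℤ) :
    ee d (ξ + lat η) = ee d ξ := by
  unfold ee
  rw [Complex.exp_eq_exp_iff_exists_int]
  refine ⟨-∑ i, (d i : ℤ) * η i, ?_⟩
  simp only [PiLp.add_apply, lat, mul_add, Finset.sum_add_distrib]
  push_cast
  ring

lemma gD_periodic {n : ℕ} (D : Finset (Fin n → ℕ)) (ξ : EuclideanSpace ℝ (Fin n)) (η : Fin n → ℤ) :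
    gD D (ξ + lat η) = gD D ξ := by
  simp only [gD_eq, ee_periodic]

lemma ee_sum_all {n : ℕ} (p : ℕ) (ξ : EuclideanSpace ℝ (Fin n)) :
    ∑ d ∈ Fintype.piFinset (fun _ : Fin n => Finset.range p), ee d ξ = ∏ i, dir1 p (ξ i) := by
  unfold dir1
  rw [Finset.prod_univ_sum]
  refine Finset.sum_congr rfl fun d _ => ?_
  rw [ee, ← Complex.exp_sum]
  congr 1
  push_cast
  rw [Finset.mul_sum, ← Finset.sum_neg_distrib, Finset.sum_mul]

/-- natural-number lattice point -/
def latN {n : ℕ} (a : Fin n → ℕ) : EuclideanSpace ℝ (Fin n) := lat fun i => (a i : ℤ)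

lemma M_bound {n : ℕ} (t p : ℕ) (D : Finset (Fin n → ℕ)) (hD : D.Nonempty)
    (hDp : ∀ d ∈ D, ∀ i, d i < p) (hc : p ^ n - t ≤ D.card) (hc2 : p ^ n ≤ 2 * D.card)
    (θ : EuclideanSpace ℝ (Fin n)) (hθ : θ ∈ box01 n) :
    ∑ a ∈ Fintype.piFinset (fun _ : Fin n => Finset.range p), ‖gD D ((p : ℝ)⁻¹ • (latN a + θ))‖ ≤
      2 * ((4 * (1 + Real.log p)) ^ n + t) := by
  classical
  set A := Fintype.piFinset (fun _ : Fin n => Finset.range p) with hA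
  have hsub : D ⊆ A := fun d hd => by
    rw [hA, Fintype.mem_piFinset]
    exact fun i => Finset.mem_range.2 (hDp d hd i)
  have hAc : A.card = p ^ n := by simp [hA]
  have hmis : ((A \ D).card : ℝ) ≤ t := by
    have := Finset.card_sdiff_of_subset hsub
    rw [hAc] at this
    exact_mod_cast (by omega : (A \ D).card ≤ t)
  have hDpos : (0 : ℝ) < D.card := by exact_mod_cast hD.card_pos
  have hpt : ∀ ξ : EuclideanSpace ℝ (Fin n),
      ‖gD D ξ‖ ≤ (D.card : ℝ)⁻¹ * ((∏ i, ‖dir1 p (ξ i)‖) + t) := by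
    intro ξ
    rw [gD_eq, norm_mul, norm_inv, Complex.norm_natCast]
    gcongr
    have h := Finset.sum_sdiff hsub (f := fun d => ee d ξ)
    rw [ee_sum_all] at h
    have h' : ∑ d ∈ D, ee d ξ = ∏ i, dir1 p (ξ i) - ∑ d ∈ A \ D, ee d ξ := by
      rw [← h]; ring
    rw [h', ← norm_prod]
    refine (norm_sub_le _ _).trans ?_
    gcongr
    refine (norm_sum_le _ _).trans ?_
    simpa [norm_ee] using hmis
  have hlog : 0 ≤ Real.log p := Real.log_natCast_nonneg p
  have hprod : ∑ a ∈ A, ∏ i, ‖dir1 p (((p : ℝ)⁻¹ • (latN a + θ)) i)‖ ≤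
      (p : ℝ) ^ n * (4 * (1 + Real.log p)) ^ n := by
    have : ∑ a ∈ A, ∏ i, ‖dir1 p (((p : ℝ)⁻¹ • (latN a + θ)) i)‖ =
        ∏ i, ∑ a ∈ Finset.range p, ‖dir1 p ((p : ℝ)⁻¹ * (a + θ i))‖ := by
      rw [Finset.prod_univ_sum]
      refine Finset.sum_congr rfl fun a _ => ?_
      simp [latN, lat, mul_add]
    rw [this, ← mul_pow]
    calc _ ≤ ∏ i : Fin n, (p * (4 * (1 + Real.log p))) :=
          Finset.prod_le_prod (fun i _ => Finset.sum_nonneg fun _ _ => norm_nonneg _)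
            fun i _ => dir1_sum p (θ i) (hθ i).1 (hθ i).2
      _ = _ := by simp
  calc _ ≤ ∑ a ∈ A, (D.card : ℝ)⁻¹ * ((∏ i, ‖dir1 p (((p : ℝ)⁻¹ • (latN a + θ)) i)‖) + t) :=
        Finset.sum_le_sum fun a _ => hpt _
    _ = (D.card : ℝ)⁻¹ * (∑ a ∈ A, ∏ i, ‖dir1 p (((p : ℝ)⁻¹ • (latN a + θ)) i)‖ + p ^ n * t) := by
        rw [← Finset.mul_sum, Finset.sum_add_distrib, Finset.sum_const, hAc]
        simp
    _ ≤ (D.card : ℝ)⁻¹ * ((p : ℝ) ^ n * (4 * (1 + Real.log p)) ^ n + p ^ n * t) := by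
        gcongr
    _ = (p : ℝ) ^ n / D.card * ((4 * (1 + Real.log p)) ^ n + t) := by ring
    _ ≤ _ := by
        have : (p : ℝ) ^ n / D.card ≤ 2 := by
          rw [div_le_iff₀ hDpos]
          exact_mod_cast hc2
        gcongr

/-- box of lattice points -/
def bx (n p k : ℕ) : Finset (Fin n → ℤ) :=
  Fintype.piFinset (fun _ : Fin n => Finset.Ico (-(p : ℤ) ^ k) ((p : ℤ) ^ k))

lemma box_rec {n p : ℕ} (hp : 2 ≤ p) (D : Finset (Fin n → ℕ)) (M : ℝ)
    (hM : ∀ θ ∈ box01 n, ∑ a ∈ Fintype.piFinset (fun _ : Fin n => Finset.range p),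
      ‖gD D ((p : ℝ)⁻¹ • (latN a + θ))‖ ≤ M) (hM0 : 0 ≤ M) (k : ℕ) :
    ∀ θ ∈ box01 n, ∑ ξ ∈ bx n p k, ∏ j ∈ Finset.range k,
      ‖gD D (((p : ℝ) ^ (j + 1))⁻¹ • (lat ξ + θ))‖ ≤ 2 ^ n * M ^ k := by
  have hp0 : (0 : ℝ) < p := by exact_mod_cast (by omega : 0 < p)
  have hpz : (0 : ℤ) < p := by exact_mod_cast (by omega : 0 < p)
  induction k with
  | zero =>
    intro θ _
    simp [bx]
  | succ k ih =>
    intro θ hθ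
    set A := Fintype.piFinset (fun _ : Fin n => Finset.range p) with hA
    have key : ∑ ξ ∈ bx n p (k + 1), ∏ j ∈ Finset.range (k + 1),
        ‖gD D (((p : ℝ) ^ (j + 1))⁻¹ • (lat ξ + θ))‖ =
        ∑ x ∈ A ×ˢ bx n p k, ‖gD D ((p : ℝ)⁻¹ • (latN x.1 + θ))‖ * ∏ j ∈ Finset.range k,
          ‖gD D (((p : ℝ) ^ (j + 1))⁻¹ • (lat x.2 + (p : ℝ)⁻¹ • (latN x.1 + θ)))‖ := by
      refine Finset.sum_nbij' (fun ξ => (fun i => (ξ i % p).toNat, fun i => ξ i / p))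
        (fun x i => (x.1 i : ℤ) + p * x.2 i) ?_ ?_ ?_ ?_ ?_
      · intro ξ hξ
        simp only [bx, Fintype.mem_piFinset, Finset.mem_Ico, Finset.mem_product, hA,
          Finset.mem_range] at hξ ⊢
        refine ⟨fun i => ?_, fun i => ⟨?_, ?_⟩⟩
        · have := Int.emod_lt_of_pos (ξ i) hpz
          have := Int.emod_nonneg (ξ i) hpz.ne'
          omega
        · rw [Int.le_ediv_iff_mul_le hpz]
          have := (hξ i).1
          rw [pow_succ] at this
          linarith
        · rw [Int.ediv_lt_iff_lt_mul hpz, ← pow_succ]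
          exact (hξ i).2
      · intro x hx
        simp only [bx, Fintype.mem_piFinset, Finset.mem_Ico, Finset.mem_product, hA,
          Finset.mem_range] at hx ⊢
        intro i
        have h1 := hx.1 i
        obtain ⟨h2, h3⟩ := hx.2 i
        have h1' : (x.1 i : ℤ) + 1 ≤ p := by exact_mod_cast h1
        have h1'' : (0 : ℤ) ≤ x.1 i := by positivity
        rw [pow_succ]
        constructor <;> nlinarith
      · intro ξ hξ
        funext i
        have h1 := Int.emod_nonneg (ξ i) hpz.ne'
        simp only [Int.toNat_of_nonneg h1]
        exact Int.emod_add_mul_ediv _ _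
      · intro x hx
        simp only [Fintype.mem_piFinset, Finset.mem_product, hA, Finset.mem_range] at hx
        have h1 : ∀ i, (x.1 i : ℤ) < p := fun i => by exact_mod_cast hx.1 i
        have h0 : ∀ i, (0 : ℤ) ≤ x.1 i := fun i => by positivity
        ext i
        · simp [Int.emod_eq_of_lt (h0 i) (h1 i)]
        · simp [Int.add_mul_ediv_left _ _ hpz.ne', Int.ediv_eq_zero_of_lt (h0 i) (h1 i)]
      · intro ξ hξ
        have hdec : lat ξ + θ = (p : ℝ) • (lat (fun i => ξ i / p) +
            (p : ℝ)⁻¹ • (latN (fun i => (ξ i % p).toNat) + θ)) := by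
          ext i
          have h1 := Int.emod_nonneg (ξ i) hpz.ne'
          have h2 : ((ξ i : ℤ) : ℝ) = ((ξ i % p : ℤ) : ℝ) + p * ((ξ i / p : ℤ) : ℝ) := by
            exact_mod_cast (Int.emod_add_mul_ediv (ξ i) p).symm
          simp only [lat, latN, PiLp.add_apply, PiLp.smul_apply, smul_eq_mul,
            Int.toNat_of_nonneg h1]
          field_simp
          rw [h2]
          ring
        rw [Finset.prod_range_succ', mul_comm]
        congr 1
        · rw [hdec, smul_smul]
          simp only [zero_add, pow_one, inv_mul_cancel₀ hp0.ne', one_smul]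
          rw [add_comm, gD_periodic]
        · refine Finset.prod_congr rfl fun j _ => ?_
          rw [hdec, smul_smul]
          congr 3
          rw [pow_succ (p : ℝ) (j + 1)]
          field_simp
    rw [key, Finset.sum_product]
    calc _ ≤ ∑ a ∈ A, ‖gD D ((p : ℝ)⁻¹ • (latN a + θ))‖ * (2 ^ n * M ^ k) := by
          refine Finset.sum_le_sum fun a ha => ?_
          dsimp only
          rw [← Finset.mul_sum]
          refine mul_le_mul_of_nonneg_left (ih _ ?_) (norm_nonneg _)
          intro i
          simp only [hA, Fintype.mem_piFinset, Finset.mem_range] at ha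
          have h1 : (a i : ℝ) + 1 ≤ p := by exact_mod_cast ha i
          obtain ⟨h2, h3⟩ := hθ i
          simp only [lat, latN, PiLp.add_apply, PiLp.smul_apply, smul_eq_mul, Int.cast_natCast]
          constructor
          · positivity
          · rw [← div_eq_inv_mul, div_le_one hp0]
            linarith
      _ = (∑ a ∈ A, ‖gD D ((p : ℝ)⁻¹ • (latN a + θ))‖) * (2 ^ n * M ^ k) := by
          rw [Finset.sum_mul]
      _ ≤ M * (2 ^ n * M ^ k) := by
          gcongr
          exact hM θ hθ
      _ = _ := by ring

lemma norm_ee_sub_one {n : ℕ} (d : Fin n → ℕ) (ξ : EuclideanSpace ℝ (Fin n)) :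
    ‖ee d ξ - 1‖ ≤ |2 * Real.pi * ∑ i, (d i : ℝ) * ξ i| := by
  have := Real.norm_exp_I_mul_ofReal_sub_one_le (x := -(2 * Real.pi * ∑ i, (d i : ℝ) * ξ i))
  rw [mul_comm, Real.norm_eq_abs, abs_neg] at this
  exact this

lemma gD_mult {n p : ℕ} (hp : 2 ≤ p) (D : Finset (Fin n → ℕ)) (hD : D.Nonempty)
    (ξ : EuclideanSpace ℝ (Fin n)) :
    Multipliable fun j : ℕ => gD D (((p : ℝ) ^ (j + 1))⁻¹ • ξ) := by
  have hp1 : (1 : ℝ) < p := by exact_mod_cast (by omega : 1 < p)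
  have hDne : (D.card : ℂ) ≠ 0 := by exact_mod_cast hD.card_pos.ne'
  have : Multipliable fun j : ℕ => 1 + (gD D (((p : ℝ) ^ (j + 1))⁻¹ • ξ) - 1) := by
    apply multipliable_one_add_of_summable
    set K := (D.card : ℝ)⁻¹ * ∑ d ∈ D, |2 * Real.pi * ∑ i, (d i : ℝ) * ξ i| with hK
    refine Summable.of_nonneg_of_le (fun _ => norm_nonneg _) (f := fun j : ℕ => K * ((p : ℝ)⁻¹) ^ (j + 1)) ?_ ?_
    · intro j
      have h1 : gD D (((p : ℝ) ^ (j + 1))⁻¹ • ξ) - 1 =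
          (D.card : ℂ)⁻¹ * ∑ d ∈ D, (ee d (((p : ℝ) ^ (j + 1))⁻¹ • ξ) - 1) := by
        rw [gD_eq, Finset.sum_sub_distrib, mul_sub]
        simp [hDne]
      rw [h1, norm_mul, norm_inv, Complex.norm_natCast, hK, mul_assoc, Finset.sum_mul]
      gcongr
      refine (norm_sum_le _ _).trans (Finset.sum_le_sum fun d _ => ?_)
      refine (norm_ee_sub_one _ _).trans (le_of_eq ?_)
      have : 2 * Real.pi * ∑ i, (d i : ℝ) * (((p : ℝ) ^ (j + 1))⁻¹ • ξ) i =
        (2 * Real.pi * ∑ i, (d i : ℝ) * ξ i) * ((p : ℝ)⁻¹) ^ (j + 1) := by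
        rw [mul_assoc (2 * Real.pi), Finset.sum_mul]
        congr 1
        refine Finset.sum_congr rfl fun i _ => ?_
        simp only [PiLp.smul_apply, smul_eq_mul, inv_pow]
        ring
      rw [this, abs_mul, abs_of_nonneg (a := ((p : ℝ)⁻¹) ^ (j + 1)) (by positivity)]
    · refine Summable.mul_left _ ?_
      exact (summable_nat_add_iff 1).2
        (summable_geometric_of_lt_one (by positivity) (inv_lt_one_of_one_lt₀ hp1))
  simpa using this

lemma norm_tprod_le_prod (f : ℕ → ℂ) (hf : Multipliable f) (h1 : ∀ j, ‖f j‖ ≤ 1) (k : ℕ) :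
    ‖∏' j, f j‖ ≤ ∏ j ∈ Finset.range k, ‖f j‖ := by
  have h := hf.hasProd.tendsto_prod_nat.norm
  refine le_of_tendsto h ?_
  filter_upwards [eventually_ge_atTop k] with m hm
  rw [norm_prod]
  rw [← Finset.prod_range_mul_prod_Ico _ hm]
  refine mul_le_of_le_one_right (Finset.prod_nonneg fun _ _ => norm_nonneg _) ?_
  exact Finset.prod_le_one (fun _ _ => norm_nonneg _) fun j _ => h1 j

lemma lat_coord {n : ℕ} (ξ : Fin n → ℤ) (i : Fin n) : |(ξ i : ℝ)| ≤ ‖lat ξ‖ := by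
  have := PiLp.norm_apply_le (lat ξ) i
  simpa [lat] using this

lemma lat_mem_bx {n p k : ℕ} (ξ : Fin n → ℤ) (R : ℝ) (hR : R < (p : ℝ) ^ k) (h : ‖lat ξ‖ ≤ R) :
    ξ ∈ bx n p k := by
  simp only [bx, Fintype.mem_piFinset, Finset.mem_Ico]
  intro i
  have h1 := abs_lt.1 (((lat_coord ξ i).trans h).trans_lt hR)
  constructor
  · exact_mod_cast h1.1.le
  · exact_mod_cast h1.2

lemma eventually_bound (n t : ℕ) (ε : ℝ) (hε : 0 < ε) :
    ∀ᶠ p : ℕ in atTop, 2 * ((4 * (1 + Real.log p)) ^ n + t) ≤ (p : ℝ) ^ ε := by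
  have hl : ∀ c : ℝ, (fun _ : ℝ => c) =o[atTop] fun x : ℝ => x ^ ε := fun c => by
    refine Asymptotics.isLittleO_const_left.2 (Or.inr ?_)
    exact tendsto_norm_atTop_atTop.comp (tendsto_rpow_atTop hε)
  have h : (fun x : ℝ => 2 * ((4 * (1 + Real.log x)) ^ n + t)) =o[atTop] fun x : ℝ => x ^ ε := by
    refine Asymptotics.IsLittleO.const_mul_left (Asymptotics.IsLittleO.add ?_ (hl _)) _
    rcases Nat.eq_zero_or_pos n with rfl | hn
    · simpa using hl 1
    have h1 : (fun x : ℝ => 4 * (1 + Real.log x)) =o[atTop] fun x : ℝ => x ^ (ε / n) := by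
      refine Asymptotics.IsLittleO.const_mul_left (Asymptotics.IsLittleO.add ?_ ?_) _
      · refine Asymptotics.isLittleO_const_left.2 (Or.inr ?_)
        exact tendsto_norm_atTop_atTop.comp (tendsto_rpow_atTop (by positivity))
      · exact isLittleO_log_rpow_atTop (by positivity)
    have h2 := h1.pow hn
    refine h2.congr' EventuallyEq.rfl ?_
    filter_upwards [eventually_ge_atTop 0] with x hx
    rw [← Real.rpow_mul_natCast hx]
    congr 1
    field_simp
  have h2 := h.bound (c := 1) one_pos
  have h3 := tendsto_natCast_atTop_atTop (R := ℝ) |>.eventually h2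
  filter_upwards [h3] with p hp
  rw [one_mul, Real.norm_eq_abs, Real.norm_eq_abs, abs_of_nonneg (a := (p : ℝ) ^ ε) (by positivity)] at hp
  exact (le_abs_self _).trans hp

/-- for fixed `n ≥ 1` and `t ≥ 1`, and every `ε > 0`, there is `p₀` such that
for every `p ≥ p₀` and every digit set `D ⊆ {0,…,p-1}ⁿ` with `#D ≥ pⁿ - t`, the missing
digits measure `λ_{p,D}` (characterised by its Fourier transform
`λ̂(ξ) = Π_{j≥1} g(p^{-j}ξ)`) satisfies `dim_{l¹} λ_{p,D} ≥ n - ε`. -/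
theorem statement9 (n t : ℕ) (hn : 1 ≤ n) (ht : 1 ≤ t) (ε : ℝ) (hε : 0 < ε) :
    ∃ p₀ : ℕ, ∀ p : ℕ, p₀ ≤ p →
      ∀ D : Finset (Fin n → ℕ), D.Nonempty → (∀ d ∈ D, ∀ i, d i < p) →
        p ^ n - t ≤ D.card →
        ∀ lam : Measure (EuclideanSpace ℝ (Fin n)), IsProbabilityMeasure lam →
          (∀ ξ : EuclideanSpace ℝ (Fin n),
            mft lam ξ = ∏' j : ℕ, gD D (((p : ℝ) ^ (j + 1))⁻¹ • ξ)) →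
          diml1 lam ≥ (n : ℝ) - ε := by
  have hev := (eventually_bound n t ε hε).and (eventually_ge_atTop (2 * t + 2))
  obtain ⟨p₀, hp₀⟩ := eventually_atTop.1 hev
  refine ⟨p₀, fun p hp D hD hDp hc lam hlam hft => ?_⟩
  obtain ⟨hMp, hpt⟩ := hp₀ p hp
  have hp2 : 2 ≤ p := by omega
  have hp1 : (1 : ℝ) < p := by exact_mod_cast (by omega : 1 < p)
  have hp0 : (0 : ℝ) < p := by linarith
  have hpn : p ≤ p ^ n := Nat.le_self_pow (by omega) p
  have hc2 : p ^ n ≤ 2 * D.card := by omega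
  unfold diml1
  rcases le_or_gt ((n : ℝ) - ε) 0 with hneg | hpos
  · exact hneg.trans (Real.sSup_nonneg fun s hs => hs.1.le)
  refine le_csSup ⟨n, ?_⟩ ⟨hpos, ?_⟩
  · rintro s ⟨hs, C, hC, h⟩
    by_contra hns
    push Not at hns
    have hlow : ∀ R : ℝ, 1 ≤ R → 1 ≤ C * R ^ ((n : ℝ) - s) := by
      intro R hR
      refine le_trans ?_ (h R hR 0 (fun i => by simp))
      unfold latSum
      have hsum : Summable fun ξ : Fin n → ℤ => if ‖lat ξ‖ ≤ R then ‖mft lam (lat ξ + 0)‖ else 0 := by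
        obtain ⟨k, hk⟩ := pow_unbounded_of_one_lt R hp1
        refine summable_of_ne_finset_zero (s := bx n p k) fun ξ hξ => ?_
        rw [if_neg fun hh => hξ (lat_mem_bx ξ R hk hh)]
      have h0 := hsum.le_tsum (0 : Fin n → ℤ) (fun ξ _ => by split_ifs <;> positivity)
      have hl0 : lat (0 : Fin n → ℤ) = 0 := by ext i; simp [lat]
      have hm0 : mft lam 0 = 1 := by simp [mft]
      rw [hl0, add_zero, hm0] at h0
      simpa [show (0 : ℝ) ≤ R by linarith] using h0
    have htend : Tendsto (fun R : ℝ => C * R ^ ((n : ℝ) - s)) atTop (𝓝 (C * 0)) := by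
      refine Tendsto.const_mul _ ?_
      have := tendsto_rpow_neg_atTop (y := s - n) (by linarith)
      simpa using this
    rw [mul_zero] at htend
    have := ge_of_tendsto htend ((eventually_ge_atTop 1).mono hlow)
    linarith
  · set M : ℝ := (p : ℝ) ^ ε with hMdef
    have hM0 : 0 ≤ M := by positivity
    refine ⟨2 ^ n * M, by positivity, fun R hR θ hθ => ?_⟩
    obtain ⟨m, hm1, hm2⟩ := exists_nat_pow_near hR hp1
    have hT := box_rec hp2 D M (fun θ hθ => (M_bound t p D hD hDp hc hc2 θ hθ).trans hMp) hM0 (m + 1) θ hθ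
    have hL : latSum lam R θ ≤ ∑ ξ ∈ bx n p (m + 1), ∏ j ∈ Finset.range (m + 1),
      ‖gD D (((p : ℝ) ^ (j + 1))⁻¹ • (lat ξ + θ))‖ := by
      unfold latSum
      rw [tsum_eq_sum (s := bx n p (m + 1)) fun ξ hξ => if_neg fun hh => hξ (lat_mem_bx ξ R hm2 hh)]
      refine Finset.sum_le_sum fun ξ _ => ?_
      split_ifs
      · rw [hft]
        exact norm_tprod_le_prod _ (gD_mult hp2 D hD _) (fun _ => norm_gD_le _ _) _
      · exact Finset.prod_nonneg fun _ _ => norm_nonneg _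
    refine hL.trans (hT.trans ?_)
    rw [pow_succ, mul_assoc, mul_comm (M ^ m) M]
    gcongr
    rw [sub_sub_cancel, hMdef, ← Real.rpow_mul_natCast hp0.le, mul_comm, Real.rpow_natCast_mul hp0.le]
    gcongr
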